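/- arXiv:1702.01114 — 8 statements merged into one kernel-verified Lean document; each statement's English description precedes it below -/
import Mathlib

section
/- The family {K_m : m ≥ 1} is a basis for a fuzzy topology on X; concretely, K_1 is the constant function 1 (so the union of the family is X), and for all integers m, l ≥ 1 the pointwise minimum of K_m and K_l equals K_{max(m,l)}. -/
open scoped Classical

/-- The family `{K_m : m ≥ 1}` is a basis for a fuzzy topology on `X`:
`K_1` is the constant function `1`, and the pointwise minimum of `K_m` and `K_l`
equals `K_{max m l}` for all `m, l ≥ 1`. -/
theorem stmt2 {X : Type*} [Nonempty X] (f : X → X) (J : ℕ → Set X) (K : ℕ → X → ℝ)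
    (hJ : ∀ n ≥ 1, J n = Set.range f^[n - 1] \ Set.range f^[n])
    (hK : ∀ m ≥ 1, ∀ x : X,
      (∀ n ≥ 1, x ∈ J n → K m x = min 1 ((n : ℝ) / (m : ℝ))) ∧
        ((∀ n ≥ 1, x ∉ J n) → K m x = 1)) :
    (∀ x : X, K 1 x = 1) ∧
      ∀ m ≥ 1, ∀ l ≥ 1, ∀ x : X, min (K m x) (K l x) = K (max m l) x := by
  refine ⟨fun x => ?_, fun m hm l hl x => ?_⟩
  · by_cases h : ∃ n ≥ 1, x ∈ J n
    · obtain ⟨n, hn, hx⟩ := h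
      rw [(hK 1 le_rfl x).1 n hn hx, Nat.cast_one, div_one]
      exact min_eq_left (Nat.one_le_cast.mpr hn)
    · push Not at h
      exact (hK 1 le_rfl x).2 h
  · by_cases h : ∃ n ≥ 1, x ∈ J n
    · obtain ⟨n, hn, hx⟩ := h
      have hanti : ∀ a ≥ 1, ∀ b, a ≤ b → K b x ≤ K a x := by
        intro a ha b hab
        rw [(hK a ha x).1 n hn hx, (hK b (ha.trans hab) x).1 n hn hx]
        have ha' : (0 : ℝ) < a := Nat.cast_pos.mpr ha
        gcongr
      rcases le_total m l with hml | hlm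
      · rw [max_eq_right hml, min_eq_right (hanti m hm l hml)]
      · rw [max_eq_left hlm, min_eq_left (hanti l hl m hlm)]
    · push Not at h
      rw [(hK m hm x).2 h, (hK l hl x).2 h, (hK _ (le_max_of_le_left hm) x).2 h, min_self]
end

section
/- The function f is surjective if and only if for every integer n ≥ 1 the fuzzy image of A_n under f equals A_n, i.e. f(A_n)(y) = A_n(y) for every y ∈ X. -/
open scoped Classical

/-- `f` is surjective iff for every `n ≥ 1` the fuzzy image of `A_n` under `f`
equals `A_n`, where the fuzzy image is `f(A)(y) = sup {A x : f x = y}`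
(with `sup ∅ = 0`). -/
theorem stmt4 {X : Type*} [Nonempty X] (f : X → X) (A : ℕ → X → ℝ)
    (hA : ∀ n ≥ 1, ∀ x : X,
      A n x = if ∃ m ≥ 1, f^[m] x = x then 1 else 1 / (n : ℝ)) :
    Function.Surjective f ↔
      ∀ n ≥ 1, ∀ y : X, sSup (A n '' {x | f x = y}) = A n y := by
  constructor
  · intro hf n hn y
    have hn' : (1 : ℝ) ≤ n := by exact_mod_cast hn
    have hle : 1 / (n : ℝ) ≤ 1 := by
      rw [div_le_one (by linarith)]
      exact hn'
    by_cases hy : ∃ m ≥ 1, f^[m] y = y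
    · rw [hA n hn y, if_pos hy]
      obtain ⟨m, hm, hmy⟩ := hy
      obtain ⟨k, rfl⟩ : ∃ k, m = k + 1 := ⟨m - 1, by omega⟩
      have hfk : f (f^[k] y) = y := by
        rw [← Function.iterate_succ_apply' f k y]
        exact hmy
      have hper : f^[k + 1] (f^[k] y) = f^[k] y := by
        rw [Function.iterate_succ_apply, hfk]
      refine IsGreatest.csSup_eq ⟨⟨f^[k] y, hfk, ?_⟩, ?_⟩
      · rw [hA n hn, if_pos ⟨k + 1, hm, hper⟩]
      · rintro _ ⟨x, -, rfl⟩
        rw [hA n hn x]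
        split_ifs
        · exact le_rfl
        · exact hle
    · rw [hA n hn y, if_neg hy]
      have hval : ∀ x, f x = y → A n x = 1 / (n : ℝ) := by
        rintro x rfl
        rw [hA n hn x, if_neg]
        rintro ⟨m, hm, hmx⟩
        refine hy ⟨m, hm, ?_⟩
        rw [← Function.iterate_succ_apply f m x, Function.iterate_succ_apply', hmx]
      obtain ⟨x, hx⟩ := hf y
      refine IsGreatest.csSup_eq ⟨⟨x, hx, hval x hx⟩, ?_⟩
      rintro _ ⟨z, hz, rfl⟩
      exact (hval z hz).le
  · intro h y
    by_contra hy
    have hempty : {x | f x = y} = ∅ :=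
      Set.eq_empty_iff_forall_notMem.2 fun x hx => hy ⟨x, hx⟩
    have h1 := h 1 le_rfl y
    rw [hempty, Set.image_empty, Real.sSup_empty, hA 1 le_rfl y] at h1
    simp at h1
end

section
/- The fuzzy topological space (X, τ₂) is connected: there do not exist τ₂-open fuzzy sets U and V, each not identically 0, such that min(U(x), V(x)) = 0 for all x ∈ X and max(U(x), V(x)) = 1 for all x ∈ X. -/
open scoped Classical

/-- `(X, τ₂)` is connected: there are no `τ₂`-open fuzzy sets `U` and `V`, each
not identically `0`, with `min (U x) (V x) = 0` and `max (U x) (V x) = 1` for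
all `x`.  A fuzzy set is `τ₂`-open iff it is the pointwise supremum of a
(possibly empty) subfamily of `{K_m : m ≥ 1}`. -/
theorem stmt12 {X : Type*} [Nonempty X] (f : X → X) (J : ℕ → Set X) (K : ℕ → X → ℝ)
    (hJ : ∀ n ≥ 1, J n = Set.range f^[n - 1] \ Set.range f^[n])
    (hK : ∀ m ≥ 1, ∀ x : X,
      (∀ n ≥ 1, x ∈ J n → K m x = min 1 ((n : ℝ) / (m : ℝ))) ∧
        ((∀ n ≥ 1, x ∉ J n) → K m x = 1))
    (IsOpen2 : (X → ℝ) → Prop)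
    (hOpen : ∀ U : X → ℝ, IsOpen2 U ↔ ∃ S : Set ℕ, (∀ m ∈ S, 1 ≤ m) ∧
      ∀ x : X, U x = sSup ((fun m => K m x) '' S)) :
    ¬ ∃ U V : X → ℝ, IsOpen2 U ∧ IsOpen2 V ∧
      (¬ ∀ x : X, U x = 0) ∧ (¬ ∀ x : X, V x = 0) ∧
      (∀ x : X, min (U x) (V x) = 0) ∧ (∀ x : X, max (U x) (V x) = 1) := by
  have K_mem : ∀ m ≥ 1, ∀ x, 0 < K m x ∧ K m x ≤ 1 := by
    intro m hm x
    by_cases h : ∃ n ≥ 1, x ∈ J n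
    · obtain ⟨n, hn, hx⟩ := h
      rw [(hK m hm x).1 n hn hx]
      have hn' : (0 : ℝ) < n := by exact_mod_cast hn
      have hm' : (0 : ℝ) < m := by exact_mod_cast hm
      exact ⟨lt_min one_pos (div_pos hn' hm'), min_le_left _ _⟩
    · push Not at h
      rw [(hK m hm x).2 h]
      exact ⟨one_pos, le_rfl⟩
  have pos_of_open : ∀ U, IsOpen2 U → (¬ ∀ x, U x = 0) → ∀ x, 0 < U x := by
    intro U hU hne x
    obtain ⟨S, hS, hSup⟩ := (hOpen U).1 hU
    obtain ⟨m, hm⟩ : S.Nonempty := by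
      by_contra hempty
      rw [Set.not_nonempty_iff_eq_empty] at hempty
      exact hne fun y => by rw [hSup y, hempty, Set.image_empty, Real.sSup_empty]
    rw [hSup x]
    refine (K_mem m (hS m hm) x).1.trans_le (le_csSup ⟨1, ?_⟩ ⟨m, hm, rfl⟩)
    rintro _ ⟨k, hk, rfl⟩
    exact (K_mem k (hS k hk) x).2
  rintro ⟨U, V, hU, hV, hU0, hV0, hmin, -⟩
  obtain ⟨x⟩ := ‹Nonempty X›
  exact (lt_min (pos_of_open U hU hU0 x) (pos_of_open V hV hV0 x)).ne' (hmin x)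
end

section
/- The fuzzy topological space (X, τ₂) is compact: every family of τ₂-open fuzzy sets whose pointwise supremum is the constant function 1 has a finite subfamily whose pointwise supremum is the constant function 1. -/
open scoped Classical

/-- `(X, τ₂)` is compact: every family of `τ₂`-open fuzzy sets whose pointwise
supremum is the constant function `1` has a finite subfamily whose pointwise
supremum is the constant function `1`.  A fuzzy set is `τ₂`-open iff it is the
pointwise supremum of a (possibly empty) subfamily of `{K_m : m ≥ 1}`. -/
theorem stmt13 {X : Type*} [Nonempty X] (f : X → X) (J : ℕ → Set X) (K : ℕ → X → ℝ)
    (hJ : ∀ n ≥ 1, J n = Set.range f^[n - 1] \ Set.range f^[n])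
    (hK : ∀ m ≥ 1, ∀ x : X,
      (∀ n ≥ 1, x ∈ J n → K m x = min 1 ((n : ℝ) / (m : ℝ))) ∧
        ((∀ n ≥ 1, x ∉ J n) → K m x = 1))
    (IsOpen2 : (X → ℝ) → Prop)
    (hOpen : ∀ U : X → ℝ, IsOpen2 U ↔ ∃ S : Set ℕ, (∀ m ∈ S, 1 ≤ m) ∧
      ∀ x : X, U x = sSup ((fun m => K m x) '' S)) :
    ∀ (ι : Type) (G : ι → X → ℝ), (∀ i, IsOpen2 (G i)) →
      (∀ x : X, (⨆ i, G i x) = 1) →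
      ∃ t : Finset ι, ∀ x : X, (⨆ i ∈ t, G i x) = 1 := by
  have hK_bounds : ∀ m ≥ 1, ∀ x, 0 ≤ K m x ∧ K m x ≤ 1 := by
    intro m hm x
    by_cases h : ∃ n ≥ 1, x ∈ J n
    · obtain ⟨n, hn, hx⟩ := h
      rw [(hK m hm x).1 n hn hx]
      exact ⟨le_min zero_le_one (by positivity), min_le_left _ _⟩
    · push Not at h
      rw [(hK m hm x).2 h]
      norm_num
  -- A generator exceeding `1 / 2` at a suitable point is constantly `1`.
  have hpoint : ∃ x₀, ∀ m ≥ 1, 1 / 2 < K m x₀ → ∀ x, K m x = 1 := by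
    by_cases hJ1 : (J 1).Nonempty
    · obtain ⟨x₀, hx₀⟩ := hJ1
      refine ⟨x₀, fun m hm hlt x => ?_⟩
      rw [(hK m hm x₀).1 1 le_rfl hx₀] at hlt
      have hm_pos : (0 : ℝ) < m := by exact_mod_cast hm
      have hlt' := hlt.trans_le (min_le_right _ _)
      rw [Nat.cast_one, div_lt_div_iff₀ two_pos hm_pos] at hlt'
      have hm_lt : m < 2 := by exact_mod_cast (by linarith : (m : ℝ) < 2)
      obtain rfl : m = 1 := by omega
      by_cases h : ∃ n ≥ 1, x ∈ J n
      · obtain ⟨n, hn, hx⟩ := h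
        rw [(hK 1 hm x).1 n hn hx, Nat.cast_one, div_one]
        exact min_eq_left (by exact_mod_cast hn)
      · push Not at h
        exact (hK 1 hm x).2 h
    · have hf : Function.Surjective f := by
        intro y
        by_contra hy
        refine hJ1 ⟨y, ?_⟩
        rw [hJ 1 le_rfl]
        exact ⟨⟨y, rfl⟩, hy⟩
      refine ⟨Classical.arbitrary X, fun m hm _ x => (hK m hm x).2 fun n hn hx => ?_⟩
      rw [hJ n hn] at hx
      exact hx.2 (hf.iterate n x)
  intro ι G hG hcover
  have hG_bounds : ∀ i x, 0 ≤ G i x ∧ G i x ≤ 1 := by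
    intro i x
    obtain ⟨S, hS, hGS⟩ := (hOpen _).1 (hG i)
    rw [hGS]
    constructor
    · apply Real.sSup_nonneg
      rintro _ ⟨m, hm, rfl⟩
      exact (hK_bounds m (hS m hm) x).1
    · refine Real.sSup_le ?_ zero_le_one
      rintro _ ⟨m, hm, rfl⟩
      exact (hK_bounds m (hS m hm) x).2
  obtain ⟨x₀, hx₀⟩ := hpoint
  have hι : Nonempty ι := by
    by_contra h
    rw [not_nonempty_iff] at h
    simpa using hcover x₀
  obtain ⟨i, hi⟩ : ∃ i, 1 / 2 < G i x₀ :=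
    exists_lt_of_lt_ciSup (by rw [hcover x₀]; norm_num)
  obtain ⟨S, hS, hGS⟩ := (hOpen _).1 (hG i)
  have hS_nonempty : S.Nonempty := by
    by_contra h
    rw [Set.not_nonempty_iff_eq_empty] at h
    rw [hGS, h, Set.image_empty, Real.sSup_empty] at hi
    norm_num at hi
  rw [hGS] at hi
  obtain ⟨_, ⟨m, hm, rfl⟩, hlt⟩ := exists_lt_of_lt_csSup (hS_nonempty.image _) hi
  have hGi : ∀ x, 1 ≤ G i x := by
    intro x
    rw [hGS, ← hx₀ m (hS m hm) hlt x]
    refine le_csSup ⟨1, ?_⟩ ⟨m, hm, rfl⟩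
    rintro _ ⟨k, hk, rfl⟩
    exact (hK_bounds k (hS k hk) x).2
  refine ⟨{i}, fun x => ?_⟩
  have hle : ∀ j, (⨆ _ : j ∈ ({i} : Finset ι), G j x) ≤ 1 := fun j =>
    Real.iSup_le (fun _ => (hG_bounds j x).2) zero_le_one
  refine le_antisymm (Real.iSup_le hle zero_le_one) ?_
  refine le_ciSup_of_le ⟨1, Set.forall_mem_range.2 hle⟩ i ?_
  rw [ciSup_pos (Finset.mem_singleton_self i)]
  exact hGi x
end

section
/- The fuzzy topological space (X, τ₃) is Lindelöf: every family of τ₃-open fuzzy sets whose pointwise supremum is the constant function 1 has a countable subfamily whose pointwise supremum is the constant function 1. -/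
open scoped Classical

/-- A nonzero supremum of a finite set of reals is attained. -/
theorem Real.sSup_mem_of_finite_of_ne_zero {s : Set ℝ} (hs : s.Finite) (h : sSup s ≠ 0) :
    sSup s ∈ s := by
  rcases s.eq_empty_or_nonempty with rfl | hne
  · simp at h
  · exact hne.csSup_mem hs

/-- If a family of functions with values in `[0, 1]` attains `1` at a point for some index in `t`,
then its supremum over `t` at this point is `1`. -/
theorem Real.biSup_eq_one {ι : Type*} {a : ι → ℝ} (ha : ∀ i, a i ≤ 1) {t : Set ι} {j : ι}
    (hj : j ∈ t) (h : a j = 1) : (⨆ i ∈ t, a i) = 1 := by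
  have hle : ∀ i, (⨆ _ : i ∈ t, a i) ≤ 1 := fun i => Real.iSup_le (fun _ => ha i) zero_le_one
  refine le_antisymm (Real.iSup_le hle zero_le_one) ?_
  refine le_ciSup_of_le ⟨1, ?_⟩ j (by simp [hj, h])
  rintro _ ⟨i, rfl⟩
  exact hle i

/-- `(X, τ₃)` is Lindelöf: every family of `τ₃`-open fuzzy sets whose pointwise
supremum is the constant function `1` has a countable subfamily whose pointwise
supremum is the constant function `1`.  A fuzzy set is `τ₃`-open iff it is the
pointwise supremum of a (possibly empty) subfamily of `{C} ∪ {C_n : n ∈ ℤ}`. -/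
theorem stmt14 {X : Type*} [Nonempty X] (f : Equiv.Perm X) (x₀ : X)
    (k : ℕ) (hk : 1 ≤ k)
    (orb : Set X) (horb : orb = {y | ∃ n : ℤ, (f ^ n) x₀ = y})
    (C : X → ℝ) (hC : ∀ x : X, C x = if x ∈ orb then 0 else 1)
    (Cn : ℤ → X → ℝ)
    (hCn : ∀ n : ℤ, ∀ x : X, Cn n x =
      if x = (f ^ n) x₀ then 1
      else if x ∈ orb then 1 / (k : ℝ) else 0)
    (IsOpen3 : (X → ℝ) → Prop)
    (hOpen : ∀ U : X → ℝ, IsOpen3 U ↔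
      ∃ S : Set (X → ℝ), S ⊆ insert C {g | ∃ n : ℤ, g = Cn n} ∧
        ∀ x : X, U x = sSup ((fun g => g x) '' S)) :
    ∀ (ι : Type) (G : ι → X → ℝ), (∀ i, IsOpen3 (G i)) →
      (∀ x : X, (⨆ i, G i x) = 1) →
      ∃ t : Set ι, t.Countable ∧ ∀ x : X, (⨆ i ∈ t, G i x) = 1 := by
  intro ι G hG hcover
  have hk1 : 1 / (k : ℝ) ≤ 1 := by
    rw [div_le_one (by positivity)]
    exact_mod_cast hk
  let V : Set ℝ := {0, 1 / (k : ℝ), 1}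
  have hVfin : V.Finite := by simp [V]
  have hVle : ∀ v ∈ V, v ≤ 1 := by
    rintro v (rfl | rfl | rfl)
    exacts [zero_le_one, hk1, le_rfl]
  have hbasic : ∀ g ∈ insert C {g | ∃ n : ℤ, g = Cn n}, ∀ x, g x ∈ V := by
    rintro g (rfl | ⟨n, rfl⟩) x
    · rw [hC]; split_ifs <;> simp [V]
    · rw [hCn]; split_ifs <;> simp [V]
  choose S hS hGS using fun i => (hOpen (G i)).1 (hG i)
  have hsub : ∀ i x, (fun g : X → ℝ => g x) '' S i ⊆ V := by
    rintro i x _ ⟨g, hg, rfl⟩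
    exact hbasic g (hS i hg) x
  have hmem : ∀ i x, G i x ≠ 0 → ∃ g ∈ S i, g x = G i x := by
    intro i x h
    rw [hGS] at h ⊢
    exact Real.sSup_mem_of_finite_of_ne_zero (hVfin.subset (hsub i x)) h
  have hGV : ∀ i x, G i x ∈ V := by
    intro i x
    by_cases h : G i x = 0
    · simp [V, h]
    · obtain ⟨g, hg, hgx⟩ := hmem i x h
      exact hgx ▸ hbasic g (hS i hg) x
  have hGle : ∀ i x, G i x ≤ 1 := fun i x => hVle _ (hGV i x)
  have hattain : ∀ x, ∃ i, G i x = 1 := by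
    intro x
    have hfin : (Set.range fun i => G i x).Finite :=
      hVfin.subset (by rintro _ ⟨i, rfl⟩; exact hGV i x)
    have h := Real.sSup_mem_of_finite_of_ne_zero hfin
      (by rw [sSup_range, hcover]; exact one_ne_zero)
    rwa [sSup_range, hcover] at h
  have hout : ∀ i x, x ∉ orb → G i x = 1 → ∀ y, y ∉ orb → G i y = 1 := by
    intro i x hx h y hy
    obtain ⟨g, hg, hgx⟩ := hmem i x (by rw [h]; exact one_ne_zero)
    rcases hS i hg with rfl | ⟨n, rfl⟩
    · refine le_antisymm (hGle i y) ?_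
      rw [hGS]
      exact le_csSup (hVfin.subset (hsub i y)).bddAbove ⟨g, hg, by simp [hC, hy]⟩
    · have hne : x ≠ (f ^ n) x₀ := by
        rintro rfl
        exact hx (horb ▸ ⟨n, rfl⟩)
      rw [hCn, if_neg hne, if_neg hx, h] at hgx
      exact absurd hgx zero_ne_one
  have horbc : orb.Countable := by
    rw [horb]
    exact Set.countable_range fun n : ℤ => (f ^ n) x₀
  choose c hc using hattain
  by_cases hX : ∃ x, x ∉ orb
  · obtain ⟨x, hx⟩ := hX
    refine ⟨insert (c x) (c '' orb), (horbc.image c).insert _, fun y => ?_⟩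
    by_cases hy : y ∈ orb
    · exact Real.biSup_eq_one (fun i => hGle i y) (.inr ⟨y, hy, rfl⟩) (hc y)
    · exact Real.biSup_eq_one (fun i => hGle i y) (.inl rfl) (hout _ x hx (hc x) y hy)
  · push Not at hX
    exact ⟨c '' orb, horbc.image c, fun y =>
      Real.biSup_eq_one (fun i => hGle i y) ⟨y, hX y, rfl⟩ (hc y)⟩
end

section
/- The fuzzy topological space (X, τ₃) is connected if and only if A(x₀) = X (equivalently, C is identically 0); here connected means there do not exist τ₃-open fuzzy sets U and V, each not identically 0, such that min(U(x), V(x)) = 0 for all x ∈ X and max(U(x), V(x)) = 1 for all x ∈ X. -/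
open scoped Classical

/-- `(X, τ₃)` is connected iff `A(x₀) = X` (equivalently, `C` is identically
`0`): connected means there are no `τ₃`-open fuzzy sets `U` and `V`, each not
identically `0`, with `min (U x) (V x) = 0` and `max (U x) (V x) = 1` for all
`x`. -/
theorem stmt15 {X : Type*} [Nonempty X] (f : Equiv.Perm X) (x₀ : X)
    (k : ℕ) (hk : 1 ≤ k)
    (orb : Set X) (horb : orb = {y | ∃ n : ℤ, (f ^ n) x₀ = y})
    (C : X → ℝ) (hC : ∀ x : X, C x = if x ∈ orb then 0 else 1)
    (Cn : ℤ → X → ℝ)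
    (hCn : ∀ n : ℤ, ∀ x : X, Cn n x =
      if x = (f ^ n) x₀ then 1
      else if x ∈ orb then 1 / (k : ℝ) else 0)
    (IsOpen3 : (X → ℝ) → Prop)
    (hOpen : ∀ U : X → ℝ, IsOpen3 U ↔
      ∃ S : Set (X → ℝ), S ⊆ insert C {g | ∃ n : ℤ, g = Cn n} ∧
        ∀ x : X, U x = sSup ((fun g => g x) '' S)) :
    (¬ ∃ U V : X → ℝ, IsOpen3 U ∧ IsOpen3 V ∧
        (¬ ∀ x : X, U x = 0) ∧ (¬ ∀ x : X, V x = 0) ∧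
        (∀ x : X, min (U x) (V x) = 0) ∧ (∀ x : X, max (U x) (V x) = 1)) ↔
      orb = Set.univ := by
  have hk0 : (0 : ℝ) < k := by exact_mod_cast hk
  have hk1 : 1 / (k : ℝ) ≤ 1 := by
    rw [div_le_one hk0]
    exact_mod_cast hk
  have hCn_le : ∀ n x, Cn n x ≤ 1 := by
    intro n x
    rw [hCn]
    split_ifs <;> linarith
  have mem_orb : ∀ n : ℤ, (f ^ n) x₀ ∈ orb := by
    intro n
    rw [horb]
    exact ⟨n, rfl⟩
  constructor
  · intro hconn
    by_contra horb_ne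
    obtain ⟨y, hy⟩ := (Set.ne_univ_iff_exists_notMem orb).1 horb_ne
    refine hconn ⟨C, fun x => if x ∈ orb then 1 else 0, ?_, ?_, ?_, ?_, ?_, ?_⟩
    · exact (hOpen C).2 ⟨{C}, by simp, by simp⟩
    · refine (hOpen _).2 ⟨{g | ∃ n : ℤ, g = Cn n}, Set.subset_insert _ _, fun x => ?_⟩
      refine (IsGreatest.csSup_eq ?_).symm
      by_cases hx : x ∈ orb
      · rw [if_pos hx]
        refine ⟨?_, ?_⟩
        · obtain ⟨n, hn⟩ := horb ▸ hx
          exact ⟨Cn n, ⟨n, rfl⟩, by simp [hCn, hn]⟩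
        · rintro _ ⟨_, ⟨n, rfl⟩, rfl⟩
          exact hCn_le n x
      · have hzero : ∀ n, Cn n x = 0 := by
          intro n
          have hne : x ≠ (f ^ n) x₀ := fun h => hx (h ▸ mem_orb n)
          rw [hCn, if_neg hne, if_neg hx]
        rw [if_neg hx]
        refine ⟨⟨Cn 0, ⟨0, rfl⟩, hzero 0⟩, ?_⟩
        rintro _ ⟨_, ⟨n, rfl⟩, rfl⟩
        exact (hzero n).le
    · intro h
      simpa [hC, hy] using h y
    · intro h
      exact one_ne_zero ((if_pos (mem_orb 0)).symm.trans (h ((f ^ (0 : ℤ)) x₀)))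
    · intro x
      by_cases hx : x ∈ orb <;> simp [hC, hx]
    · intro x
      by_cases hx : x ∈ orb <;> simp [hC, hx]
  · rintro huniv ⟨U, V, hU, hV, hU0, hV0, hmin, -⟩
    have hC0 : ∀ x, C x = 0 := by simp [hC, huniv]
    have open_pos : ∀ W, IsOpen3 W → (¬ ∀ x, W x = 0) → ∀ x, 0 < W x := by
      intro W hW hW0 x
      obtain ⟨S, hS, hWS⟩ := (hOpen W).1 hW
      obtain ⟨n, hn⟩ : ∃ n, Cn n ∈ S := by
        by_contra! hno
        refine hW0 fun z => ?_
        rw [hWS]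
        have hS0 : ∀ r ∈ (fun g : X → ℝ => g z) '' S, r = 0 := by
          rintro _ ⟨g, hg, rfl⟩
          rcases hS hg with rfl | ⟨n, rfl⟩
          · exact hC0 z
          · exact absurd hg (hno n)
        exact le_antisymm (Real.sSup_nonpos fun r hr => (hS0 r hr).le)
          (Real.sSup_nonneg fun r hr => (hS0 r hr).ge)
      have hbdd : BddAbove ((fun g : X → ℝ => g x) '' S) := by
        refine ⟨1, ?_⟩
        rintro _ ⟨g, hg, rfl⟩
        rcases hS hg with rfl | ⟨m, rfl⟩
        · exact (hC0 x).trans_le zero_le_one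
        · exact hCn_le m x
      have hpos : 0 < Cn n x := by
        rw [hCn, if_pos (huniv ▸ Set.mem_univ x : x ∈ orb)]
        split_ifs <;> positivity
      rw [hWS]
      exact hpos.trans_le (le_csSup hbdd ⟨Cn n, hn, rfl⟩)
    exact (lt_min (open_pos U hU hU0 x₀) (open_pos V hV hV0 x₀)).ne' (hmin x₀)
end

section
/- Assume k ≥ 2. The fuzzy topological space (X, τ₃) is compact if and only if the orbit A(x₀) is a finite set; here compact means every family of τ₃-open fuzzy sets whose pointwise supremum is the constant function 1 has a finite subfamily whose pointwise supremum is the constant function 1. -/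
open scoped Classical

lemma iSup_finset_mem_le {ι : Type*} {t : Finset ι} {a : ι → ℝ} {b : ℝ} (hb : 0 ≤ b)
    (h : ∀ i ∈ t, a i ≤ b) : (⨆ i ∈ t, a i) ≤ b :=
  Real.iSup_le (fun i => Real.iSup_le (fun hi => h i hi) hb) hb

lemma iSup_finset_mem_eq_one {ι : Type*} {t : Finset ι} {a : ι → ℝ} (h : ∀ i, a i ≤ 1)
    {j : ι} (hj : j ∈ t) (ha : a j = 1) : (⨆ i ∈ t, a i) = 1 := by
  refine le_antisymm (iSup_finset_mem_le zero_le_one fun i _ => h i) ?_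
  have hbdd : BddAbove (Set.range fun i => ⨆ (_ : i ∈ t), a i) :=
    ⟨1, by rintro _ ⟨i, rfl⟩; exact Real.iSup_le (fun _ => h i) zero_le_one⟩
  calc (1 : ℝ) = ⨆ (_ : j ∈ t), a j := by
        have : Nonempty (j ∈ t) := ⟨hj⟩
        rw [ciSup_const, ha]
    _ ≤ _ := le_ciSup hbdd j

/-- If all members of a family of reals in `[0, 1]` other than `1` are at most `c`,
then so is its supremum, unless it equals `1`. -/
lemma sSup_eq_one_or_le {s : Set ℝ} {c : ℝ} (hc : 0 ≤ c) (h1 : ∀ r ∈ s, r ≤ 1)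
    (h : ∀ r ∈ s, r = 1 ∨ r ≤ c) : sSup s = 1 ∨ sSup s ≤ c := by
  by_cases hs : (1 : ℝ) ∈ s
  · exact Or.inl (le_antisymm (Real.sSup_le h1 zero_le_one) (le_csSup ⟨1, h1⟩ hs))
  · refine Or.inr (Real.sSup_le (fun r hr => (h r hr).resolve_left ?_) hc)
    rintro rfl
    exact hs hr

/-- Assume `k ≥ 2`.  Then `(X, τ₃)` is compact iff the orbit `A(x₀)` is a
finite set, where compact means every family of `τ₃`-open fuzzy sets whose
pointwise supremum is the constant function `1` has a finite subfamily whose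
pointwise supremum is the constant function `1`. -/
theorem stmt16 {X : Type*} [Nonempty X] (f : Equiv.Perm X) (x₀ : X)
    (k : ℕ) (hk : 2 ≤ k)
    (orb : Set X) (horb : orb = {y | ∃ n : ℤ, (f ^ n) x₀ = y})
    (C : X → ℝ) (hC : ∀ x : X, C x = if x ∈ orb then 0 else 1)
    (Cn : ℤ → X → ℝ)
    (hCn : ∀ n : ℤ, ∀ x : X, Cn n x =
      if x = (f ^ n) x₀ then 1
      else if x ∈ orb then 1 / (k : ℝ) else 0)
    (IsOpen3 : (X → ℝ) → Prop)
    (hOpen : ∀ U : X → ℝ, IsOpen3 U ↔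
      ∃ S : Set (X → ℝ), S ⊆ insert C {g | ∃ n : ℤ, g = Cn n} ∧
        ∀ x : X, U x = sSup ((fun g => g x) '' S)) :
    (∀ (ι : Type) (G : ι → X → ℝ), (∀ i, IsOpen3 (G i)) →
        (∀ x : X, (⨆ i, G i x) = 1) →
        ∃ t : Finset ι, ∀ x : X, (⨆ i ∈ t, G i x) = 1) ↔
      orb.Finite := by
  have hk0 : (0 : ℝ) ≤ 1 / (k : ℝ) := by positivity
  have hk1 : 1 / (k : ℝ) < 1 := by
    have : (2 : ℝ) ≤ k := by exact_mod_cast hk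
    rw [div_lt_one (by linarith)]
    linarith
  have hmem (n : ℤ) : (f ^ n) x₀ ∈ orb := by rw [horb]; exact ⟨n, rfl⟩
  have hgen : ∀ g ∈ insert C {g | ∃ n : ℤ, g = Cn n},
      (∀ x, g x = 1 ∨ g x ≤ 1 / (k : ℝ)) ∧ ∀ x y, x ∉ orb → y ∉ orb → g x = g y := by
    rintro g (rfl | ⟨n, rfl⟩)
    · refine ⟨fun x => ?_, fun x y hx hy => by simp [hC, hx, hy]⟩
      rw [hC]
      split_ifs
      exacts [Or.inr hk0, Or.inl rfl]
    · refine ⟨fun x => ?_, fun x y hx hy => ?_⟩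
      · rw [hCn]
        split_ifs
        exacts [Or.inl rfl, Or.inr le_rfl, Or.inr hk0]
      · have hx' : x ≠ (f ^ n) x₀ := fun h => hx (h ▸ hmem n)
        have hy' : y ≠ (f ^ n) x₀ := fun h => hy (h ▸ hmem n)
        simp [hCn, hx, hy, hx', hy']
  have hval (U : X → ℝ) (hU : IsOpen3 U) (x : X) : U x = 1 ∨ U x ≤ 1 / (k : ℝ) := by
    obtain ⟨S, hS, hUS⟩ := (hOpen U).1 hU
    have h : ∀ r ∈ (fun g : X → ℝ => g x) '' S, r = 1 ∨ r ≤ 1 / (k : ℝ) := by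
      rintro _ ⟨g, hg, rfl⟩
      exact (hgen g (hS hg)).1 x
    rw [hUS]
    exact sSup_eq_one_or_le hk0 (fun r hr => (h r hr).elim le_of_eq fun h => h.trans hk1.le) h
  have hconst (U : X → ℝ) (hU : IsOpen3 U) (x y : X) (hx : x ∉ orb) (hy : y ∉ orb) :
      U x = U y := by
    obtain ⟨S, hS, hUS⟩ := (hOpen U).1 hU
    rw [hUS, hUS, Set.image_congr fun g hg => (hgen g (hS hg)).2 x y hx hy]
  have hle (U : X → ℝ) (hU : IsOpen3 U) (x : X) : U x ≤ 1 :=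
    (hval U hU x).elim le_of_eq fun h => h.trans hk1.le
  have hopen_gen : ∀ g ∈ insert C {g | ∃ n : ℤ, g = Cn n}, IsOpen3 g := fun g hg =>
    (hOpen g).2 ⟨{g}, Set.singleton_subset_iff.2 hg, fun x => by simp⟩
  constructor
  · intro hcomp
    let G : Option ℤ → X → ℝ := fun i => i.elim C Cn
    have hG : ∀ i, IsOpen3 (G i) := by
      rintro (_ | n)
      exacts [hopen_gen C (Or.inl rfl), hopen_gen (Cn n) (Or.inr ⟨n, rfl⟩)]
    have hcover (x : X) : (⨆ i, G i x) = 1 := by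
      obtain ⟨i, hi⟩ : ∃ i, G i x = 1 := by
        by_cases hx : x ∈ orb
        · have hx' := hx
          rw [horb] at hx'
          obtain ⟨n, rfl⟩ := hx'
          exact ⟨some n, by simp [G, hCn]⟩
        · exact ⟨none, by simp [G, hC, hx]⟩
      refine le_antisymm (Real.iSup_le (fun i => hle _ (hG i) x) zero_le_one) ?_
      rw [← hi]
      exact le_ciSup (f := fun i => G i x)
        ⟨1, by rintro _ ⟨i, rfl⟩; exact hle _ (hG i) x⟩ i
    obtain ⟨t, ht⟩ := hcomp (Option ℤ) G hG hcover
    refine (t.image fun i => i.elim x₀ fun n => (f ^ n) x₀).finite_toSet.subset fun y hy => ?_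
    by_contra hyt
    refine hk1.not_ge ((ht y).symm.le.trans (iSup_finset_mem_le hk0 ?_))
    rintro (_ | n) hi
    · simp [G, hC, hy]
    · have hne : y ≠ (f ^ n) x₀ := fun h =>
        hyt (Finset.mem_coe.2 (Finset.mem_image.2 ⟨some n, hi, h.symm⟩))
      simp [G, hCn, hy, hne]
  · intro hfin ι G hG hcover
    have hattain (x : X) : ∃ i, G i x = 1 := by
      by_contra! hne
      refine hk1.not_ge ((hcover x).symm.le.trans (Real.iSup_le (fun i => ?_) hk0))
      exact (hval _ (hG i) x).resolve_left (hne i)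
    choose c hc using hattain
    obtain ⟨z, hz⟩ : ∃ z, ∀ x, x ∉ orb → z ∉ orb := by
      by_cases h : ∃ z, z ∉ orb
      · exact h.imp fun z hz _ _ => hz
      · exact ⟨x₀, fun x hx => (h ⟨x, hx⟩).elim⟩
    refine ⟨insert (c z) (hfin.toFinset.image c), fun x => ?_⟩
    by_cases hx : x ∈ orb
    · exact iSup_finset_mem_eq_one (fun i => hle _ (hG i) x)
        (Finset.mem_insert_of_mem
          (Finset.mem_image_of_mem c (hfin.mem_toFinset.2 hx))) (hc x)
    · exact iSup_finset_mem_eq_one (fun i => hle _ (hG i) x) (Finset.mem_insert_self _ _)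
        ((hconst _ (hG _) x z hx (hz x hx)).trans (hc z))
end

section
/- Suppose f : X → X is a bijection and the orbit A(x₀) is not all of X. Then the fuzzy topologies τ₁ and τ₃ on X are distinct: the fuzzy set C is τ₃-open and not identically 0, but C is not τ₁-open, because C(x₀) = 0 while every τ₁-open fuzzy set that is not identically 0 is strictly positive at every point of X. -/
open scoped Classical

/-- Suppose `f : X → X` is a bijection (modelled as a permutation) and the
orbit `A(x₀)` is not all of `X`.  Then the fuzzy topologies `τ₁` and `τ₃` on
`X` are distinct: `C` is `τ₃`-open and not identically `0`, but `C` is not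
`τ₁`-open, because `C x₀ = 0` while every `τ₁`-open fuzzy set that is not
identically `0` is strictly positive at every point of `X`. -/
theorem stmt18 {X : Type*} [Nonempty X] (f : Equiv.Perm X) (x₀ : X)
    (k : ℕ) (hk : 1 ≤ k)
    (A : ℕ → X → ℝ)
    (hA : ∀ n ≥ 1, ∀ x : X,
      A n x = if ∃ m ≥ 1, (⇑f)^[m] x = x then 1 else 1 / (n : ℝ))
    (IsOpen1 : (X → ℝ) → Prop)
    (hOpen1 : ∀ U : X → ℝ, IsOpen1 U ↔ ∃ S : Set ℕ, (∀ n ∈ S, 1 ≤ n) ∧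
      ∀ x : X, U x = sSup ((fun n => A n x) '' S))
    (orb : Set X) (horb : orb = {y | ∃ n : ℤ, (f ^ n) x₀ = y})
    (C : X → ℝ) (hC : ∀ x : X, C x = if x ∈ orb then 0 else 1)
    (Cn : ℤ → X → ℝ)
    (hCn : ∀ n : ℤ, ∀ x : X, Cn n x =
      if x = (f ^ n) x₀ then 1
      else if x ∈ orb then 1 / (k : ℝ) else 0)
    (IsOpen3 : (X → ℝ) → Prop)
    (hOpen3 : ∀ U : X → ℝ, IsOpen3 U ↔
      ∃ S : Set (X → ℝ), S ⊆ insert C {g | ∃ n : ℤ, g = Cn n} ∧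
        ∀ x : X, U x = sSup ((fun g => g x) '' S))
    (horb_ne : orb ≠ Set.univ) :
    IsOpen3 C ∧ (¬ ∀ x : X, C x = 0) ∧ ¬ IsOpen1 C ∧ C x₀ = 0 ∧
      (∀ U : X → ℝ, IsOpen1 U → (¬ ∀ x : X, U x = 0) → ∀ x : X, 0 < U x) ∧
      IsOpen1 ≠ IsOpen3 := by
  have hx₀ : x₀ ∈ orb := by
    rw [horb]
    exact ⟨0, by simp⟩
  obtain ⟨y, hy⟩ := (Set.ne_univ_iff_exists_notMem orb).1 horb_ne
  have hC0 : C x₀ = 0 := by rw [hC, if_pos hx₀]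
  have hCne : ¬ ∀ x : X, C x = 0 := fun h => by
    have hCy := h y
    rw [hC, if_neg hy] at hCy
    exact one_ne_zero hCy
  have hC3 : IsOpen3 C := (hOpen3 C).2 ⟨{C}, by simp, fun x => by simp⟩
  have hA_pos : ∀ n ≥ 1, ∀ x, 0 < A n x := by
    intro n hn x
    have : (0 : ℝ) < n := by exact_mod_cast hn
    rw [hA n hn x]
    split_ifs <;> positivity
  have hA_le : ∀ n ≥ 1, ∀ x, A n x ≤ 1 := by
    intro n hn x
    have h1 : (1 : ℝ) ≤ n := by exact_mod_cast hn
    rw [hA n hn x]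
    split_ifs
    · exact le_rfl
    · exact (div_le_one (by linarith)).2 h1
  have hpos : ∀ U : X → ℝ, IsOpen1 U → (¬ ∀ x : X, U x = 0) → ∀ x : X, 0 < U x := by
    intro U hU hne x
    obtain ⟨S, hS, hUS⟩ := (hOpen1 U).1 hU
    rcases S.eq_empty_or_nonempty with rfl | ⟨n, hn⟩
    · exact absurd (fun z => by simp [hUS z]) hne
    · rw [hUS x]
      refine (hA_pos n (hS n hn) x).trans_le (le_csSup ⟨1, ?_⟩ ⟨n, hn, rfl⟩)
      rintro _ ⟨m, hm, rfl⟩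
      exact hA_le m (hS m hm) x
  have hC1 : ¬ IsOpen1 C := fun h => (hpos C h hCne x₀).ne' hC0
  exact ⟨hC3, hCne, hC1, hC0, hpos, fun h => hC1 (h ▸ hC3)⟩
end
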